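/- Let d ≥ 1 and let c be an integer with 1 ≤ c ≤ d. There is a constant C > 0, depending only on d, c and p, such that for every weight w on ℝ^d, setting W = 𝔐_c 𝔐_{c-1} ⋯ 𝔐_1 w (the composition of the strong maximal operators of complexities c, c−1, …, 1 applied to w), for every p > 1, every locally integrable f and every t > 0 one has w({x ∈ ℝ^d : 𝔐_c f(x) > t})^{1/p} ≤ (C/t) ‖f‖_{L^p(ℝ^d, W)}. -/

import Mathlib

open MeasureTheory ENNReal

/-- The strong maximal operator of complexity `c` in `ℝ^d`, acting on `ℝ≥0∞`-valued
functions: the supremum of averages over all axis-parallel rectangles (boxes) containing `x`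
whose side lengths take at most `c` distinct values. -/
noncomputable def strongMaximal (d c : ℕ) (f : (Fin d → ℝ) → ℝ≥0∞) (x : Fin d → ℝ) : ℝ≥0∞ :=
  ⨆ (a : Fin d → ℝ) (b : Fin d → ℝ) (_ : ∀ i, a i < b i)
    (_ : (Finset.image (fun i => b i - a i) Finset.univ).card ≤ c)
    (_ : x ∈ Set.Icc a b),
      (∫⁻ y in Set.Icc a b, f y) / volume (Set.Icc a b)

/-- `iterMaximal d c w = 𝔐_c 𝔐_{c-1} ⋯ 𝔐_1 w`. -/
noncomputable def iterMaximal (d : ℕ) : ℕ → ((Fin d → ℝ) → ℝ≥0∞) → ((Fin d → ℝ) → ℝ≥0∞)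
  | 0, g => g
  | c + 1, g => strongMaximal d (c + 1) (iterMaximal d c g)

/-- The uncentred one-dimensional maximal function over rational intervals. -/
noncomputable def intervalMaximal (h : ℝ → ℝ≥0∞) (x : ℝ) : ℝ≥0∞ :=
  ⨆ q : ℚ × ℚ, (Set.Ioo (q.1 : ℝ) q.2).indicator
    (fun _ => (∫⁻ y in Set.Icc (q.1 : ℝ) q.2, h y) / ENNReal.ofReal (q.2 - q.1)) x

lemma lintegral_Icc_le_intervalMaximal (h : ℝ → ℝ≥0∞) {α β x : ℝ} (hαβ : α < β)
    (hx : x ∈ Set.Icc α β) :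
    ∫⁻ y in Set.Icc α β, h y ≤ ENNReal.ofReal (β - α) * (2 * intervalMaximal h x) := by
  obtain ⟨u, hu1, hu2⟩ := exists_rat_btwn (show α - (β - α) / 2 < α by linarith)
  obtain ⟨v, hv1, hv2⟩ := exists_rat_btwn (show β < β + (β - α) / 2 by linarith)
  have hlen : (0 : ℝ) < v - u := by linarith
  have h1 : (∫⁻ y in Set.Icc (u : ℝ) v, h y) / ENNReal.ofReal (v - u) ≤ intervalMaximal h x := by
    refine le_trans ?_ (le_iSup _ (u, v))
    rw [Set.indicator_of_mem]
    exact ⟨hu2.trans_le hx.1, hx.2.trans_lt hv1⟩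
  rw [ENNReal.div_le_iff (by simpa using hlen) ENNReal.ofReal_ne_top] at h1
  calc ∫⁻ y in Set.Icc α β, h y ≤ ∫⁻ y in Set.Icc (u : ℝ) v, h y :=
        lintegral_mono_set (Set.Icc_subset_Icc hu2.le hv1.le)
    _ ≤ intervalMaximal h x * ENNReal.ofReal (v - u) := h1
    _ ≤ intervalMaximal h x * ENNReal.ofReal (2 * (β - α)) := by
        gcongr; linarith
    _ = _ := by
        rw [ENNReal.ofReal_mul (by norm_num)]
        simp only [ENNReal.ofReal_ofNat]; ring

lemma measurable_intervalMaximal (h : ℝ → ℝ≥0∞) : Measurable (intervalMaximal h) :=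
  Measurable.iSup fun _ => measurable_const.indicator measurableSet_Ioo

lemma volume_lt_intervalMaximal_le (h : ℝ → ℝ≥0∞) {t : ℝ} (ht : 0 < t) :
    volume {x | ENNReal.ofReal t < intervalMaximal h x}
      ≤ ENNReal.ofReal (5 / t) * ∫⁻ x, h x := by
  by_cases hfin : ∫⁻ x, h x = ∞
  · rw [hfin, ENNReal.mul_top (by simpa using by positivity)]
    exact le_top
  set T : Set (ℚ × ℚ) := {q | (q.1 : ℝ) < q.2 ∧
    ENNReal.ofReal (t * (q.2 - q.1)) ≤ ∫⁻ y in Set.Icc (q.1 : ℝ) q.2, h y} with hT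
  have hball : ∀ q : ℚ × ℚ, Metric.closedBall (((q.1 : ℝ) + q.2) / 2) (((q.2 : ℝ) - q.1) / 2)
      = Set.Icc (q.1 : ℝ) q.2 := by
    intro q
    rw [Real.closedBall_eq_Icc]
    congr 1 <;> ring
  have hr : ∀ q ∈ T, ((q.2 : ℝ) - q.1) / 2 ≤ (∫⁻ x, h x).toReal / t := by
    rintro q ⟨hq1, hq2⟩
    have h2 : ENNReal.ofReal (t * (q.2 - q.1)) ≤ ∫⁻ x, h x := hq2.trans (setLIntegral_le_lintegral _ _)
    rw [ENNReal.ofReal_le_iff_le_toReal hfin] at h2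
    rw [le_div_iff₀ ht]
    nlinarith
  obtain ⟨u, huT, hdisj, hcov⟩ := Vitali.exists_disjoint_subfamily_covering_enlargement_closedBall
    T (fun q : ℚ × ℚ => ((q.1 : ℝ) + q.2) / 2) (fun q => ((q.2 : ℝ) - q.1) / 2) _ hr 5 (by norm_num)
  simp only [hball] at hdisj hcov
  have hsub : {x | ENNReal.ofReal t < intervalMaximal h x} ⊆
      ⋃ q ∈ u, Metric.closedBall (((q.1 : ℝ) + q.2) / 2) (5 * (((q.2 : ℝ) - q.1) / 2)) := by
    intro x hx
    obtain ⟨q, hq⟩ := lt_iSup_iff.1 (show _ < intervalMaximal h x from hx)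
    have hxq : x ∈ Set.Ioo (q.1 : ℝ) q.2 := by
      by_contra hcon
      rw [Set.indicator_of_notMem hcon] at hq
      exact ENNReal.not_lt_zero hq
    rw [Set.indicator_of_mem hxq] at hq
    have hlt : (q.1 : ℝ) < q.2 := hxq.1.trans hxq.2
    have hqT : q ∈ T := by
      refine ⟨hlt, ?_⟩
      rw [ENNReal.ofReal_mul ht.le]
      exact (ENNReal.le_div_iff_mul_le (Or.inl (by simpa using hlt)) (Or.inl ENNReal.ofReal_ne_top)).1 hq.le
    obtain ⟨b, hb, hsub⟩ := hcov q hqT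
    exact Set.mem_biUnion hb (hsub ⟨hxq.1.le, hxq.2.le⟩)
  have hucount : u.Countable := Set.to_countable u
  calc volume {x | ENNReal.ofReal t < intervalMaximal h x}
      ≤ volume (⋃ q ∈ u, Metric.closedBall (((q.1 : ℝ) + q.2) / 2) (5 * (((q.2 : ℝ) - q.1) / 2))) :=
        measure_mono hsub
    _ ≤ ∑' q : u, volume (Metric.closedBall (((q.1.1 : ℝ) + q.1.2) / 2)
          (5 * (((q.1.2 : ℝ) - q.1.1) / 2))) := measure_biUnion_le _ hucount _
    _ ≤ ∑' q : u, ENNReal.ofReal (5 / t) * ∫⁻ y in Set.Icc (q.1.1 : ℝ) q.1.2, h y := by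
        refine ENNReal.tsum_le_tsum fun q => ?_
        rw [Real.volume_closedBall]
        calc ENNReal.ofReal (2 * (5 * (((q.1.2 : ℝ) - q.1.1) / 2)))
            = ENNReal.ofReal (5 / t) * ENNReal.ofReal (t * (q.1.2 - q.1.1)) := by
              rw [← ENNReal.ofReal_mul (by positivity)]
              congr 1; field_simp
          _ ≤ _ := by
              gcongr
              exact (huT q.2).2
    _ = ENNReal.ofReal (5 / t) * ∫⁻ y in ⋃ q ∈ u, Set.Icc (q.1 : ℝ) q.2, h y := by
        rw [ENNReal.tsum_mul_left, lintegral_biUnion hucount (fun _ _ => measurableSet_Icc) hdisj]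
    _ ≤ _ := by
        gcongr
        exact Measure.restrict_le_self

lemma intervalMaximal_le_add (h : ℝ → ℝ≥0∞) (s : ℝ≥0∞) (x : ℝ) :
    intervalMaximal h x ≤ intervalMaximal ({y | s < h y}.indicator h) x + s := by
  refine iSup_le fun q => ?_
  by_cases hx : x ∈ Set.Ioo (q.1 : ℝ) q.2
  swap
  · rw [Set.indicator_of_notMem hx]; exact zero_le
  have hlt : (q.1 : ℝ) < q.2 := hx.1.trans hx.2
  refine le_trans ?_ (add_le_add_left (le_iSup _ q) s)
  rw [Set.indicator_of_mem hx, Set.indicator_of_mem hx]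
  have h0 : ENNReal.ofReal ((q.2 : ℝ) - q.1) ≠ 0 := by simpa using hlt
  calc (∫⁻ y in Set.Icc (q.1 : ℝ) q.2, h y) / ENNReal.ofReal (q.2 - q.1)
      ≤ (∫⁻ y in Set.Icc (q.1 : ℝ) q.2, ({y | s < h y}.indicator h y + s))
          / ENNReal.ofReal (q.2 - q.1) := by
        gcongr with y
        by_cases hy : s < h y
        · rw [Set.indicator_of_mem (by exact hy)]; exact le_self_add
        · exact (not_lt.1 hy).trans le_add_self
    _ = _ := by
        rw [lintegral_add_right _ measurable_const, ENNReal.add_div]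
        simp only [lintegral_const, MeasurableSet.univ, Measure.restrict_apply, Set.univ_inter,
          Real.volume_Icc]
        rw [ENNReal.mul_div_cancel_right h0 ENNReal.ofReal_ne_top]

lemma volume_lt_intervalMaximal_le_setLIntegral (h : ℝ → ℝ≥0∞) {t : ℝ}
    (ht : 0 < t) :
    volume {x | ENNReal.ofReal t < intervalMaximal h x}
      ≤ ENNReal.ofReal (10 / t) * ∫⁻ x, {y | ENNReal.ofReal (t / 2) < h y}.indicator h x := by
  refine (measure_mono ?_).trans ((volume_lt_intervalMaximal_le
    ({y | ENNReal.ofReal (t / 2) < h y}.indicator h) (half_pos ht)).trans_eq ?_)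
  · intro x hx
    by_contra hcon
    have h1 := intervalMaximal_le_add h (ENNReal.ofReal (t / 2)) x
    have h2 : intervalMaximal h x ≤ ENNReal.ofReal (t / 2) + ENNReal.ofReal (t / 2) :=
      h1.trans (add_le_add_left (not_lt.1 hcon) _)
    rw [← ENNReal.ofReal_add (by positivity) (by positivity), add_halves] at h2
    exact absurd hx (not_lt.2 h2)
  · congr 2; field_simp; norm_num

lemma rpow_le_lintegral_Ioi {p : ℝ} (hp : 1 < p) (y : ℝ≥0∞) :
    y ^ p ≤ ∫⁻ s in Set.Ioi (0 : ℝ),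
      {s : ℝ | ENNReal.ofReal s < y}.indicator (fun s => ENNReal.ofReal (p * s ^ (p - 1))) s := by
  have key : ∀ b : ℝ, 0 ≤ b → ENNReal.ofReal b ≤ y → ENNReal.ofReal b ^ p ≤
      ∫⁻ s in Set.Ioi (0 : ℝ), {s : ℝ | ENNReal.ofReal s < y}.indicator
        (fun s => ENNReal.ofReal (p * s ^ (p - 1))) s := by
    intro b hb hby
    have hi : IntervalIntegrable (fun s : ℝ => p * s ^ (p - 1)) volume 0 b :=
      (intervalIntegral.intervalIntegrable_rpow' (by linarith)).const_mul p
    have hint : ∫ s in (0 : ℝ)..b, p * s ^ (p - 1) = b ^ p := by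
      rw [intervalIntegral.integral_const_mul, integral_rpow (Or.inl (by linarith)),
        sub_add_cancel, Real.zero_rpow (by linarith)]
      field_simp; simp
    rw [ENNReal.ofReal_rpow_of_nonneg hb (by linarith), ← hint,
      intervalIntegral.integral_of_le hb,
      ofReal_integral_eq_lintegral_ofReal ((intervalIntegrable_iff_integrableOn_Ioc_of_le hb).1 hi)
        ((ae_restrict_iff' measurableSet_Ioc).2 (.of_forall fun s hs => by
          have := hs.1.le; positivity)),
      ← restrict_Ioo_eq_restrict_Ioc]
    rw [← lintegral_indicator measurableSet_Ioo, ← lintegral_indicator measurableSet_Ioi]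
    refine lintegral_mono fun s => ?_
    by_cases hs : s ∈ Set.Ioo 0 b
    · rw [Set.indicator_of_mem hs, Set.indicator_of_mem (show s ∈ Set.Ioi 0 from hs.1),
        Set.indicator_of_mem]
      exact lt_of_lt_of_le ((ENNReal.ofReal_lt_ofReal_iff (hs.1.trans hs.2)).2 hs.2) hby
    · rw [Set.indicator_of_notMem hs]; exact zero_le
  by_cases hy : y = ∞
  · subst hy
    rw [ENNReal.top_rpow_of_pos (by linarith), top_le_iff]
    refine ENNReal.eq_top_of_forall_nnreal_le fun r => ?_
    have := key ((r : ℝ) ^ (1 / p)) (by positivity) le_top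
    rwa [ENNReal.ofReal_rpow_of_nonneg (by positivity) (by linarith), ← Real.rpow_mul r.coe_nonneg,
      one_div_mul_cancel (by linarith), Real.rpow_one, ENNReal.ofReal_coe_nnreal] at this
  · have := key y.toReal ENNReal.toReal_nonneg (ENNReal.ofReal_toReal hy).le
    rwa [ENNReal.ofReal_toReal hy] at this

lemma lintegral_Ioi_le_rpow {p : ℝ} (hp : 1 < p) (y : ℝ≥0∞) :
    ∫⁻ s in Set.Ioi (0 : ℝ), {s : ℝ | ENNReal.ofReal (s / 2) < y}.indicator
      (fun s => ENNReal.ofReal (s ^ (p - 2))) s ≤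
      ENNReal.ofReal (2 ^ (p - 1) / (p - 1)) * y ^ (p - 1) := by
  have hp1 : 0 < p - 1 := by linarith
  by_cases hy : y = ∞
  · subst hy
    rw [ENNReal.top_rpow_of_pos hp1, ENNReal.mul_top (by simpa using by positivity)]
    exact le_top
  lift y to NNReal using hy
  set b : ℝ := 2 * y with hbdef
  have hb : 0 ≤ b := by positivity
  have hi : IntervalIntegrable (fun s : ℝ => s ^ (p - 2)) volume 0 b :=
    intervalIntegral.intervalIntegrable_rpow' (by linarith)
  have hint : ∫ s in (0 : ℝ)..b, s ^ (p - 2) = b ^ (p - 1) / (p - 1) := by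
    rw [integral_rpow (Or.inl (by linarith)), show p - 2 + 1 = p - 1 by ring,
      Real.zero_rpow hp1.ne', sub_zero]
  have hR : ENNReal.ofReal (2 ^ (p - 1) / (p - 1)) * (y : ℝ≥0∞) ^ (p - 1)
      = ENNReal.ofReal (b ^ (p - 1) / (p - 1)) := by
    rw [← ENNReal.ofReal_coe_nnreal, ENNReal.ofReal_rpow_of_nonneg y.coe_nonneg hp1.le,
      ← ENNReal.ofReal_mul (by positivity), hbdef, Real.mul_rpow (by norm_num) y.coe_nonneg]
    congr 1; ring
  rw [hR, ← hint, intervalIntegral.integral_of_le hb,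
      ofReal_integral_eq_lintegral_ofReal ((intervalIntegrable_iff_integrableOn_Ioc_of_le hb).1 hi)
        ((ae_restrict_iff' measurableSet_Ioc).2 (.of_forall fun s hs => by
          have := hs.1.le; positivity)),
    ← lintegral_indicator measurableSet_Ioc, ← lintegral_indicator measurableSet_Ioi]
  refine lintegral_mono fun s => ?_
  by_cases hs : s ∈ Set.Ioi 0
  swap
  · rw [Set.indicator_of_notMem hs]; exact zero_le
  rw [Set.indicator_of_mem hs]
  by_cases hs2 : ENNReal.ofReal (s / 2) < y
  swap
  · rw [Set.indicator_of_notMem (by exact hs2)]; exact zero_le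
  rw [Set.indicator_of_mem (by exact hs2), Set.indicator_of_mem]
  refine ⟨hs, ?_⟩
  rw [← ENNReal.ofReal_coe_nnreal, ENNReal.ofReal_lt_ofReal_iff_of_nonneg
    (by have : (0:ℝ) < s := hs; positivity)] at hs2
  linarith

lemma lintegral_intervalMaximal_rpow_le {p : ℝ} (hp : 1 < p) {h : ℝ → ℝ≥0∞} (hh : Measurable h) :
    ∫⁻ x, intervalMaximal h x ^ p ≤
      ENNReal.ofReal (10 * p * (2 ^ (p - 1) / (p - 1))) * ∫⁻ x, h x ^ p := by
  have hp1 : 0 < p - 1 := by linarith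
  have hM := measurable_intervalMaximal h
  calc ∫⁻ x, intervalMaximal h x ^ p
      ≤ ∫⁻ x, ∫⁻ s in Set.Ioi (0 : ℝ), {s : ℝ | ENNReal.ofReal s < intervalMaximal h x}.indicator
          (fun s => ENNReal.ofReal (p * s ^ (p - 1))) s :=
        lintegral_mono fun x => rpow_le_lintegral_Ioi hp _
    _ = ∫⁻ s in Set.Ioi (0 : ℝ), ∫⁻ x, {s : ℝ | ENNReal.ofReal s < intervalMaximal h x}.indicator
          (fun s => ENNReal.ofReal (p * s ^ (p - 1))) s := by
        refine lintegral_lintegral_swap (Measurable.aemeasurable ?_)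
        refine Measurable.indicator (f := fun z : ℝ × ℝ => ENNReal.ofReal (p * z.2 ^ (p - 1)))
          (s := {z : ℝ × ℝ | ENNReal.ofReal z.2 < intervalMaximal h z.1}) (by fun_prop)
          (measurableSet_lt (by fun_prop) (by fun_prop))
    _ = ∫⁻ s in Set.Ioi (0 : ℝ), ENNReal.ofReal (p * s ^ (p - 1)) *
          volume {x | ENNReal.ofReal s < intervalMaximal h x} := by
        refine lintegral_congr fun s => ?_
        rw [← lintegral_indicator_const (measurableSet_lt measurable_const hM)]
        rfl
    _ ≤ ∫⁻ s in Set.Ioi (0 : ℝ), ENNReal.ofReal (10 * p) * ∫⁻ x,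
          h x * {s : ℝ | ENNReal.ofReal (s / 2) < h x}.indicator
            (fun s => ENNReal.ofReal (s ^ (p - 2))) s := by
        refine setLIntegral_mono' measurableSet_Ioi fun s hs => ?_
        have hs0 : (0 : ℝ) < s := hs
        calc _ ≤ ENNReal.ofReal (p * s ^ (p - 1)) * (ENNReal.ofReal (10 / s) *
              ∫⁻ x, {y | ENNReal.ofReal (s / 2) < h y}.indicator h x) := by
              gcongr
              exact volume_lt_intervalMaximal_le_setLIntegral h hs0
          _ = ENNReal.ofReal (10 * p) * (ENNReal.ofReal (s ^ (p - 2)) *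
              ∫⁻ x, {y | ENNReal.ofReal (s / 2) < h y}.indicator h x) := by
              rw [← mul_assoc, ← mul_assoc, ← ENNReal.ofReal_mul (by positivity),
                ← ENNReal.ofReal_mul (by positivity)]
              congr 2
              rw [show p - 1 = (p - 2) + 1 by ring, Real.rpow_add_one hs0.ne']
              field_simp
          _ = _ := by
              rw [← lintegral_const_mul _ (hh.indicator (measurableSet_lt measurable_const hh))]
              congr 2
              ext x
              by_cases hx : ENNReal.ofReal (s / 2) < h x <;> simp [Set.indicator, hx, mul_comm]
    _ = ∫⁻ x, ENNReal.ofReal (10 * p) * (h x * ∫⁻ s in Set.Ioi (0 : ℝ),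
          {s : ℝ | ENNReal.ofReal (s / 2) < h x}.indicator
            (fun s => ENNReal.ofReal (s ^ (p - 2))) s) := by
        have hmeas : Measurable fun z : ℝ × ℝ => h z.2 *
            {s : ℝ | ENNReal.ofReal (s / 2) < h z.2}.indicator
              (fun s => ENNReal.ofReal (s ^ (p - 2))) z.1 := by
          refine (hh.comp measurable_snd).mul ?_
          exact Measurable.indicator (f := fun z : ℝ × ℝ => ENNReal.ofReal (z.1 ^ (p - 2)))
            (s := {z : ℝ × ℝ | ENNReal.ofReal (z.1 / 2) < h z.2}) (by fun_prop)
            (measurableSet_lt (by fun_prop) (by fun_prop))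
        rw [lintegral_const_mul' _ _ ENNReal.ofReal_ne_top,
          lintegral_const_mul' _ _ ENNReal.ofReal_ne_top,
          lintegral_lintegral_swap hmeas.aemeasurable]
        congr 2
        ext x
        rw [lintegral_const_mul]
        exact Measurable.indicator (by fun_prop) (measurableSet_lt (by fun_prop) (by fun_prop))
    _ ≤ ∫⁻ x, ENNReal.ofReal (10 * p) * (h x * (ENNReal.ofReal (2 ^ (p - 1) / (p - 1)) *
          h x ^ (p - 1))) := by
        gcongr with x
        exact lintegral_Ioi_le_rpow hp _
    _ = _ := by
        rw [ENNReal.ofReal_mul (p := 10 * p) (by positivity), ← lintegral_const_mul _ (by fun_prop)]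
        refine lintegral_congr fun x => ?_
        have : h x ^ p = h x * h x ^ (p - 1) := by
          conv_rhs => rw [← ENNReal.rpow_one (h x), ← ENNReal.rpow_mul, one_mul]
          rw [← ENNReal.rpow_add_of_nonneg _ _ zero_le_one hp1.le]
          congr 1; ring
        rw [this]; ring

lemma measurable_intervalMaximal_update {d : ℕ} (i : Fin d) {g : (Fin d → ℝ) → ℝ≥0∞}
    (hg : Measurable g) :
    Measurable fun x : Fin d → ℝ => intervalMaximal (fun s => g (Function.update x i s)) (x i) := by
  unfold intervalMaximal
  refine Measurable.iSup fun q => ?_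
  refine Measurable.indicator (f := fun x : Fin d → ℝ =>
    (∫⁻ y in Set.Icc (q.1 : ℝ) q.2, g (Function.update x i y)) / ENNReal.ofReal (q.2 - q.1))
    (s := {x | x i ∈ Set.Ioo (q.1 : ℝ) q.2}) ?_ (measurable_pi_apply i measurableSet_Ioo)
  refine Measurable.div_const ?_ _
  exact Measurable.lintegral_prod_right' (f := fun z : (Fin d → ℝ) × ℝ =>
    g (Function.update z.1 i z.2)) (hg.comp measurable_update')

lemma lintegral_intervalMaximal_update_rpow_le {d : ℕ} (i : Fin d) {p : ℝ} (hp : 1 < p)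
    {g : (Fin d → ℝ) → ℝ≥0∞} (hg : Measurable g) :
    ∫⁻ x : Fin d → ℝ, intervalMaximal (fun s => g (Function.update x i s)) (x i) ^ p ≤
      ENNReal.ofReal (10 * p * (2 ^ (p - 1) / (p - 1))) * ∫⁻ x, g x ^ p := by
  set C := ENNReal.ofReal (10 * p * (2 ^ (p - 1) / (p - 1)))
  rw [← lintegral_const_mul _ (by fun_prop)]
  refine lintegral_le_of_lmarginal_le (μ := fun _ : Fin d => (volume : Measure ℝ)) {i}
    ((measurable_intervalMaximal_update i hg).pow_const p) (by fun_prop) ?_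
  rw [lmarginal_singleton, lmarginal_singleton]
  intro x
  simp only [Function.update_idem, Function.update_self]
  rw [lintegral_const_mul _ (by fun_prop)]
  exact lintegral_intervalMaximal_rpow_le hp (h := fun s => g (Function.update x i s)) (by fun_prop)

/-- The maximal theorem for rectangles, phrased through a majorant of the partial averages. -/
lemma exists_lmarginal_majorant {d : ℕ} {p : ℝ} (hp : 1 < p) (s : Finset (Fin d)) :
    ∃ K : ℝ≥0∞, K ≠ ∞ ∧ ∀ g : (Fin d → ℝ) → ℝ≥0∞, Measurable g →
      ∃ T : (Fin d → ℝ) → ℝ≥0∞, Measurable T ∧ ∫⁻ x, T x ^ p ≤ K * ∫⁻ x, g x ^ p ∧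
        ∀ a b : Fin d → ℝ, (∀ i, a i < b i) → ∀ x, (∀ j ∈ s, x j ∈ Set.Icc (a j) (b j)) →
          lmarginal (fun j => volume.restrict (Set.Icc (a j) (b j))) s g x
            ≤ (∏ j ∈ s, ENNReal.ofReal (b j - a j)) * T x := by
  induction s using Finset.induction_on with
  | empty => exact ⟨1, one_ne_top, fun g hg => ⟨g, hg, by simp, by simp⟩⟩
  | insert i s his ih =>
    obtain ⟨K, hK, ih⟩ := ih
    set C := ENNReal.ofReal (10 * p * (2 ^ (p - 1) / (p - 1)))
    refine ⟨2 ^ p * C * K, ?_, fun g hg => ?_⟩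
    · have : (2 : ℝ≥0∞) ^ p ≠ ∞ := ENNReal.rpow_ne_top_of_nonneg (by linarith) (by simp)
      exact ENNReal.mul_ne_top (ENNReal.mul_ne_top this ofReal_ne_top) hK
    obtain ⟨T, hT, hTp, hTle⟩ := ih g hg
    refine ⟨fun x => 2 * intervalMaximal (fun s => T (Function.update x i s)) (x i),
      (measurable_intervalMaximal_update i hT).const_mul 2, ?_, ?_⟩
    · simp_rw [ENNReal.mul_rpow_of_nonneg _ _ (show 0 ≤ p by linarith)]
      rw [lintegral_const_mul _ ((measurable_intervalMaximal_update i hT).pow_const p)]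
      calc _ ≤ 2 ^ p * (C * ∫⁻ x, T x ^ p) := by
            gcongr
            exact lintegral_intervalMaximal_update_rpow_le i hp hT
        _ ≤ 2 ^ p * (C * (K * ∫⁻ x, g x ^ p)) := by gcongr
        _ = _ := by ring
    · intro a b hab x hx
      rw [lmarginal_insert _ hg his, Finset.prod_insert his]
      have hTu : Measurable fun y => T (Function.update x i y) := by fun_prop
      calc _ ≤ ∫⁻ y in Set.Icc (a i) (b i),
            (∏ j ∈ s, ENNReal.ofReal (b j - a j)) * T (Function.update x i y) := by
            refine lintegral_mono fun y => hTle a b hab _ fun j hj => ?_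
            rw [Function.update_of_ne (by rintro rfl; exact his hj)]
            exact hx j (Finset.mem_insert_of_mem hj)
        _ = (∏ j ∈ s, ENNReal.ofReal (b j - a j)) *
              ∫⁻ y in Set.Icc (a i) (b i), T (Function.update x i y) :=
            lintegral_const_mul _ hTu
        _ ≤ (∏ j ∈ s, ENNReal.ofReal (b j - a j)) * (ENNReal.ofReal (b i - a i) *
              (2 * intervalMaximal (fun s => T (Function.update x i s)) (x i))) := by
            gcongr
            exact lintegral_Icc_le_intervalMaximal (fun y => T (Function.update x i y)) (hab i)
              (hx i (Finset.mem_insert_self _ _))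
        _ = _ := by ring

lemma volume_Icc_ne_zero {d : ℕ} {a b : Fin d → ℝ} (hab : ∀ i, a i < b i) :
    volume (Set.Icc a b) ≠ 0 := by
  rw [Real.volume_Icc_pi, Finset.prod_ne_zero_iff]
  intro i _
  simpa using hab i

lemma volume_Icc_ne_top {d : ℕ} (a b : Fin d → ℝ) : volume (Set.Icc a b) ≠ ∞ := by
  rw [Real.volume_Icc_pi]
  exact ENNReal.prod_ne_top fun _ _ => ENNReal.ofReal_ne_top

lemma exists_average_majorant (d : ℕ) {p : ℝ} (hp : 1 < p) :
    ∃ K : ℝ≥0∞, K ≠ ∞ ∧ ∀ g : (Fin d → ℝ) → ℝ≥0∞, Measurable g →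
      ∃ T : (Fin d → ℝ) → ℝ≥0∞, Measurable T ∧ ∫⁻ x, T x ^ p ≤ K * ∫⁻ x, g x ^ p ∧
        ∀ a b : Fin d → ℝ, (∀ i, a i < b i) → ∀ x ∈ Set.Icc a b,
          (∫⁻ y in Set.Icc a b, g y) / volume (Set.Icc a b) ≤ T x := by
  obtain ⟨K, hK, h⟩ := exists_lmarginal_majorant (d := d) hp Finset.univ
  refine ⟨K, hK, fun g hg => ?_⟩
  obtain ⟨T, hT, hTp, hTle⟩ := h g hg
  refine ⟨T, hT, hTp, fun a b hab x hx => ?_⟩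
  have h1 := hTle a b hab x fun j _ => ⟨hx.1 j, hx.2 j⟩
  rw [lmarginal_univ, ← Measure.restrict_pi_pi, Set.pi_univ_Icc] at h1
  rw [ENNReal.div_le_iff (volume_Icc_ne_zero hab) (volume_Icc_ne_top a b), mul_comm,
    Real.volume_Icc_pi]
  exact h1

lemma exists_sparse_subfamily {ι X : Type*} [MeasurableSpace X] (μ : Measure X)
    {B : ι → Set X} (hB : ∀ i, MeasurableSet (B i)) (L : ι → ℝ) (F : Finset ι)
    (hfin : ∀ i ∈ F, μ (B i) ≠ ∞) :
    ∃ G ⊆ F, ∃ E : ι → Set X, (∀ i, MeasurableSet (E i)) ∧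
      (∀ i ∈ G, E i ⊆ B i ∧ μ (B i) ≤ 2 * μ (E i)) ∧ (G : Set ι).PairwiseDisjoint E ∧
      ∀ i ∈ F, μ (B i) ≤ 2 * μ (B i ∩ ⋃ j ∈ {j ∈ G | L i ≤ L j}, B j) := by
  classical
  induction F using Finset.induction_on_min_value L with
  | empty => exact ⟨∅, by simp, fun _ => ∅, by simp⟩
  | insert i F hiF hmin ih =>
    obtain ⟨G, hGF, E, hE, hEB, hdisj, hcov⟩ := ih fun j hj => hfin j (Finset.mem_insert_of_mem hj)
    have hU : MeasurableSet (⋃ j ∈ G, B j) := Finset.measurableSet_biUnion _ fun j _ => hB j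
    have hfilt : {j ∈ G | L i ≤ L j} = G :=
      Finset.filter_true_of_mem fun j hj => hmin j (hGF hj)
    by_cases hi : μ (B i) ≤ 2 * μ (B i ∩ ⋃ j ∈ G, B j)
    · refine ⟨G, hGF.trans (Finset.subset_insert _ _), E, hE, hEB, hdisj, fun j hj => ?_⟩
      rcases Finset.mem_insert.1 hj with rfl | hj
      · rwa [hfilt]
      · exact hcov j hj
    · have hne : ∀ j ∈ G, j ≠ i := fun j hj h => hiF (h ▸ hGF hj)
      refine ⟨insert i G, Finset.insert_subset_insert i hGF,
        Function.update E i (B i \ ⋃ j ∈ G, B j), ?_, ?_, ?_, ?_⟩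
      · intro j
        by_cases hj : j = i
        · subst hj; rw [Function.update_self]; exact (hB _).diff hU
        · rw [Function.update_of_ne hj]; exact hE j
      · intro j hj
        rcases Finset.mem_insert.1 hj with rfl | hj
        · rw [Function.update_self]
          refine ⟨Set.sdiff_subset, ?_⟩
          have h1 := measure_inter_add_sdiff (μ := μ) (B j) hU
          have hf := hfin j (Finset.mem_insert_self _ _)
          have hlt := not_le.1 hi
          rw [← h1, two_mul] at hlt
          have hne1 : μ (B j ∩ ⋃ k ∈ G, B k) ≠ ∞ := ne_top_of_le_ne_top hf (measure_mono Set.inter_subset_left)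
          have h2 := (ENNReal.add_lt_add_iff_left hne1).1 hlt
          rw [← h1, two_mul]
          gcongr
        · rw [Function.update_of_ne (hne j hj)]; exact hEB j hj
      · rw [Finset.coe_insert]
        refine Set.PairwiseDisjoint.insert ?_ ?_
        · intro j hj k hk hjk
          simp only [Function.onFun]
          rw [Function.update_of_ne (hne j hj), Function.update_of_ne (hne k hk)]
          exact hdisj hj hk hjk
        · intro j hj _
          rw [Function.update_self, Function.update_of_ne (hne j hj)]
          refine Set.disjoint_left.2 fun x hx hxj => hx.2 ?_
          exact Set.mem_biUnion (Finset.mem_coe.1 hj) ((hEB j hj).1 hxj)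
      · intro j hj
        rcases Finset.mem_insert.1 hj with rfl | hj
        · have hsub : B j ⊆ ⋃ k ∈ {k ∈ insert j G | L j ≤ L k}, B k :=
            fun x hx => Set.mem_biUnion (x := j) (by simp) hx
          rw [Set.inter_eq_left.2 hsub, two_mul]
          exact le_self_add
        · refine (hcov j hj).trans ?_
          gcongr 2 * μ (B j ∩ ?_)
          refine Set.iUnion₂_subset fun k hk => ?_
          obtain ⟨hk1, hk2⟩ := Finset.mem_filter.1 hk
          exact Set.subset_biUnion_of_mem (u := B)
            (Finset.mem_filter.2 ⟨Finset.mem_insert_of_mem hk1, hk2⟩)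

lemma volume_image_coord_affine {d : ℕ} (D u : Fin d → ℝ) (E : Set (Fin d → ℝ)) :
    volume ((fun y i => u i + D i * y i) '' E) = ENNReal.ofReal |∏ i, D i| * volume E := by
  have : (fun y : Fin d → ℝ => fun i => u i + D i * y i)
      = (fun y => u + y) ∘ (Matrix.toLin' (Matrix.diagonal D)) := by
    ext y i
    simp [Matrix.mulVec_diagonal]
  rw [this, Set.image_comp, Set.image_add_left, measure_preimage_add,
    Measure.addHaar_image_linearMap, LinearMap.det_toLin', Matrix.det_diagonal]

/-- The set of coordinates in which the rectangle `[q.1, q.2]` is longest. -/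
noncomputable def longestCoords {d : ℕ} (q : (Fin d → ℝ) × (Fin d → ℝ)) : Finset (Fin d) :=
  {i | ∀ j, q.2 j - q.1 j ≤ q.2 i - q.1 i}

lemma average_le_strongMaximal {d c : ℕ} (f : (Fin d → ℝ) → ℝ≥0∞) {a b x : Fin d → ℝ}
    (hab : ∀ i, a i < b i) (hc : (Finset.image (fun i => b i - a i) Finset.univ).card ≤ c)
    (hx : x ∈ Set.Icc a b) :
    (∫⁻ y in Set.Icc a b, f y) / volume (Set.Icc a b) ≤ strongMaximal d c f x :=
  le_iSup_of_le a <| le_iSup_of_le b <| le_iSup_of_le hab <| le_iSup_of_le hc <|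
    le_iSup_of_le hx le_rfl

/-- If half of a rectangle is covered by rectangles that are at least as long in the same longest
directions, then shortening its longest sides keeps it half covered by their dilates. -/
lemma exists_shortened_rectangle {d : ℕ} {S : Finset (Fin d)} {i₀ : Fin d} (hi₀ : i₀ ∈ S)
    {q : (Fin d → ℝ) × (Fin d → ℝ)} (hq : ∀ i, q.1 i < q.2 i) (hqS : longestCoords q = S)
    {G : Finset ((Fin d → ℝ) × (Fin d → ℝ))}
    (hGS : ∀ r ∈ G, longestCoords r = S) {c : ℕ}
    (hGL : ∀ r ∈ G, q.2 i₀ - q.1 i₀ ≤ r.2 i₀ - r.1 i₀)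
    (hqc : (Finset.image (fun i => q.2 i - q.1 i) Finset.univ).card ≤ c + 1)
    (hhalf : volume (Set.Icc q.1 q.2) ≤
      2 * volume (Set.Icc q.1 q.2 ∩ ⋃ r ∈ G, Set.Icc r.1 r.2))
    {A : Set (Fin d → ℝ)}
    (hGA : ∀ r ∈ G, Set.Icc (2 • r.1 - r.2) (2 • r.2 - r.1) ⊆ A)
    {k : Fin d} (hk : k ∉ S) {x : Fin d → ℝ} (hx : x ∈ Set.Icc q.1 q.2) :
    ∃ a b : Fin d → ℝ, (∀ i, a i < b i) ∧
      (Finset.image (fun i => b i - a i) Finset.univ).card ≤ c ∧ x ∈ Set.Icc a b ∧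
      volume (Set.Icc a b) ≤ 2 * volume (Set.Icc a b ∩ A) := by
  set l := q.2 k - q.1 k with hl
  set L := q.2 i₀ - q.1 i₀ with hL
  have hl0 : 0 < l := sub_pos.2 (hq k)
  have hlong : ∀ r : (Fin d → ℝ) × (Fin d → ℝ), longestCoords r = S → ∀ i ∈ S, ∀ j,
      r.2 j - r.1 j ≤ r.2 i - r.1 i := by
    intro r hr i hi
    rw [← hr, longestCoords, Finset.mem_filter] at hi
    exact hi.2
  have hS : ∀ i ∈ S, q.2 i - q.1 i = L := fun i hi =>
    le_antisymm (hlong q hqS i₀ hi₀ i) (hlong q hqS i hi i₀)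
  have hnS : ∀ i ∉ S, q.2 i - q.1 i ≠ L := by
    intro i hi h
    apply hi
    rw [← hqS, longestCoords, Finset.mem_filter]
    exact ⟨Finset.mem_univ _, fun j => by rw [h]; exact hlong q hqS i₀ hi₀ j⟩
  have hlL : l < L := lt_of_le_of_ne (hlong q hqS i₀ hi₀ k) (hnS k hk)
  have hL0 : 0 < L := hl0.trans hlL
  set a : Fin d → ℝ := fun i => if i ∈ S then max (q.1 i) (x i - l) else q.1 i with ha
  set b : Fin d → ℝ := fun i => if i ∈ S then a i + l else q.2 i with hb
  have hlen : ∀ i, b i - a i = if i ∈ S then l else q.2 i - q.1 i := by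
    intro i
    by_cases hi : i ∈ S <;> simp [ha, hb, hi]
  have haq : ∀ i, q.1 i ≤ a i := by
    intro i
    by_cases hi : i ∈ S <;> simp [ha, hi]
  have hbq : ∀ i, b i ≤ q.2 i := by
    intro i
    by_cases hi : i ∈ S
    · have h1 := hS i hi
      have h2 := hx.2 i
      simp only [hb, ha, hi, if_true]
      rw [← max_add_add_right]
      exact max_le (by linarith) (by linarith)
    · simp [hb, hi]
  have hab : ∀ i, a i < b i := by
    intro i
    have := hlen i
    have := hq i
    split_ifs at * <;> linarith
  set D : Fin d → ℝ := fun i => if i ∈ S then l / L else 1 with hD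
  set u : Fin d → ℝ := fun i => a i - D i * q.1 i with hu
  have hDpos : ∀ i, 0 < D i := by
    intro i
    by_cases hi : i ∈ S <;> simp [hD, hi]
    positivity
  have hDlen : ∀ i, D i * (q.2 i - q.1 i) = b i - a i := by
    intro i
    rw [hlen]
    by_cases hi : i ∈ S
    · simp only [hD, hi, if_true, hS i hi]; field_simp
    · simp [hD, hi]
  have hvol : volume (Set.Icc a b) = ENNReal.ofReal |∏ i, D i| * volume (Set.Icc q.1 q.2) := by
    rw [Real.volume_Icc_pi, Real.volume_Icc_pi, abs_of_nonneg (Finset.prod_nonneg fun i _ => (hDpos i).le),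
      ENNReal.ofReal_prod_of_nonneg fun i _ => (hDpos i).le, ← Finset.prod_mul_distrib]
    refine Finset.prod_congr rfl fun i _ => ?_
    rw [← ENNReal.ofReal_mul (hDpos i).le, hDlen]
  refine ⟨a, b, hab, ?_, ⟨fun i => ?_, fun i => ?_⟩, ?_⟩
  · have hsub : Finset.image (fun i => b i - a i) Finset.univ ⊆
        (Finset.image (fun i => q.2 i - q.1 i) Finset.univ).erase L := by
      intro z hz
      obtain ⟨i, -, rfl⟩ := Finset.mem_image.1 hz
      simp only [hlen]
      by_cases hi : i ∈ S
      · simp only [hi, if_true]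
        exact Finset.mem_erase.2 ⟨hlL.ne, Finset.mem_image_of_mem _ (Finset.mem_univ k)⟩
      · simp only [hi, if_false]
        exact Finset.mem_erase.2 ⟨hnS i hi, Finset.mem_image_of_mem (fun i => q.2 i - q.1 i) (Finset.mem_univ i)⟩
    have h1 := Finset.card_le_card hsub
    rw [Finset.card_erase_of_mem (Finset.mem_image_of_mem (fun i => q.2 i - q.1 i) (Finset.mem_univ i₀))] at h1
    omega
  · have := hx.1 i
    by_cases hi : i ∈ S
    · simp only [ha, hi, if_true]; exact max_le this (by linarith)
    · simpa [ha, hi] using this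
  · have := hx.2 i
    by_cases hi : i ∈ S
    · simp only [hb, ha, hi, if_true]
      linarith [le_max_right (q.1 i) (x i - l)]
    · simpa [hb, hi] using this
  · set E := Set.Icc q.1 q.2 ∩ ⋃ r ∈ G, Set.Icc r.1 r.2 with hE
    have himg : (fun y i => u i + D i * y i) '' E ⊆ Set.Icc a b ∩ A := by
      rintro _ ⟨y, ⟨hyq, hyG⟩, rfl⟩
      obtain ⟨r, hr, hyr⟩ := Set.mem_iUnion₂.1 hyG
      have hin : ∀ i, a i ≤ u i + D i * y i ∧ u i + D i * y i ≤ b i := by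
        intro i
        have h1 := mul_le_mul_of_nonneg_left (hyq.1 i) (hDpos i).le
        have h2 := mul_le_mul_of_nonneg_left (hyq.2 i) (hDpos i).le
        have h3 := hDlen i
        simp only [hu]
        constructor <;> nlinarith
      refine ⟨⟨fun i => (hin i).1, fun i => (hin i).2⟩, hGA r hr ?_⟩
      have hstar : ∀ i, 2 * r.1 i - r.2 i ≤ u i + D i * y i ∧
          u i + D i * y i ≤ 2 * r.2 i - r.1 i := by
        intro i
        have h1 := hyr.1 i
        have h2 := hyr.2 i
        by_cases hi : i ∈ S
        · have h3 := hlong r (hGS r hr) i hi i₀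
          have h4 := hGL r hr
          have h5 := hS i hi
          have h6 := hyq.1 i
          have h7 := hyq.2 i
          have h8 := haq i
          have h9 := hbq i
          have h10 := hin i
          constructor <;> linarith
        · have h11 : u i + D i * y i = y i := by simp [hu, hD, ha, hi]
          rw [h11]
          constructor <;> linarith
      refine ⟨fun i => ?_, fun i => ?_⟩
      · simpa using (hstar i).1
      · simpa using (hstar i).2
    calc volume (Set.Icc a b) = ENNReal.ofReal |∏ i, D i| * volume (Set.Icc q.1 q.2) := hvol
      _ ≤ ENNReal.ofReal |∏ i, D i| * (2 * volume E) := by gcongr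
      _ = 2 * volume ((fun y i => u i + D i * y i) '' E) := by
          rw [volume_image_coord_affine]; ring
      _ ≤ _ := by gcongr

lemma setLIntegral_biUnion_finset_le {ι X : Type*} [MeasurableSpace X] {μ : Measure X}
    (s : Finset ι) (B : ι → Set X) (w : X → ℝ≥0∞) :
    ∫⁻ x in ⋃ i ∈ s, B i, w x ∂μ ≤ ∑ i ∈ s, ∫⁻ x in B i, w x ∂μ := by
  classical
  induction s using Finset.induction_on with
  | empty => simp
  | insert i s his ih =>
    rw [Finset.set_biUnion_insert, Finset.sum_insert his]
    exact (lintegral_union_le _ _ _).trans (by gcongr)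

lemma lt_strongMaximal_indicator {d c : ℕ} {a b x : Fin d → ℝ} {A : Set (Fin d → ℝ)}
    (hA : MeasurableSet A) (hab : ∀ i, a i < b i)
    (hc : (Finset.image (fun i => b i - a i) Finset.univ).card ≤ c) (hx : x ∈ Set.Icc a b)
    (hhalf : volume (Set.Icc a b) ≤ 2 * volume (Set.Icc a b ∩ A)) :
    1 / 4 < strongMaximal d c (A.indicator 1) x := by
  refine lt_of_lt_of_le ?_ (average_le_strongMaximal _ hab hc hx)
  rw [lintegral_indicator_one hA, Measure.restrict_apply hA, Set.inter_comm]
  have h0 := volume_Icc_ne_zero hab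
  have htop := volume_Icc_ne_top a b
  calc (1 : ℝ≥0∞) / 4 < 1 / 2 := by
        rw [one_div, one_div, ENNReal.inv_lt_inv]; norm_num
    _ ≤ _ := by
        rw [ENNReal.le_div_iff_mul_le (Or.inl h0) (Or.inl htop)]
        calc 1 / 2 * volume (Set.Icc a b) ≤ 1 / 2 * (2 * volume (Set.Icc a b ∩ A)) := by gcongr
          _ = _ := by
            rw [← mul_assoc, ENNReal.div_mul_cancel (by simp) (by simp), one_mul]

lemma volume_dilate {d : ℕ} (a b : Fin d → ℝ) :
    volume (Set.Icc (2 • a - b) (2 • b - a)) = 3 ^ d * volume (Set.Icc a b) := by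
  rw [Real.volume_Icc_pi, Real.volume_Icc_pi]
  have : ∀ i, ENNReal.ofReal ((2 • b - a) i - (2 • a - b) i) = 3 * ENNReal.ofReal (b i - a i) := by
    intro i
    rw [show (2 • b - a) i - (2 • a - b) i = 3 * (b i - a i) by simp; ring,
      ENNReal.ofReal_mul (by norm_num)]
    simp
  simp_rw [this]
  rw [Finset.prod_mul_distrib]
  simp

lemma card_image_mul_le {d : ℕ} (a b a' b' : Fin d → ℝ) (k : ℝ)
    (h : ∀ i, b' i - a' i = k * (b i - a i)) :
    (Finset.image (fun i => b' i - a' i) Finset.univ).card ≤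
      (Finset.image (fun i => b i - a i) Finset.univ).card := by
  have : Finset.image (fun i => b' i - a' i) Finset.univ =
      (Finset.image (fun i => b i - a i) Finset.univ).image (fun z => k * z) := by
    rw [Finset.image_image]
    exact Finset.image_congr fun i _ => h i
  rw [this]
  exact Finset.card_image_le

lemma Icc_subset_dilate {d : ℕ} {a b : Fin d → ℝ} (hab : ∀ i, a i < b i) :
    Set.Icc a b ⊆ Set.Icc (2 • a - b) (2 • b - a) := by
  refine Set.Icc_subset_Icc (fun i => ?_) (fun i => ?_)
  · have := hab i; simp; linarith
  · have := hab i; simp; linarith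

lemma dilate_lt {d : ℕ} {a b : Fin d → ℝ} (hab : ∀ i, a i < b i) (i : Fin d) :
    (2 • a - b) i < (2 • b - a) i := by
  have := hab i; simp; linarith

/-- A rectangle half covered by rectangles of the same type that are at least as long lies in the
set where the maximal function of lower complexity of their dilates is large. -/
lemma subset_dilates {d c : ℕ} {S : Finset (Fin d)} {i₀ : Fin d} (hi₀ : i₀ ∈ S)
    {q : (Fin d → ℝ) × (Fin d → ℝ)} (hq : ∀ i, q.1 i < q.2 i) (hqS : longestCoords q = S)
    {G : Finset ((Fin d → ℝ) × (Fin d → ℝ))} (hGS : ∀ r ∈ G, longestCoords r = S)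
    (hGL : ∀ r ∈ G, q.2 i₀ - q.1 i₀ ≤ r.2 i₀ - r.1 i₀)
    (hqc : (Finset.image (fun i => q.2 i - q.1 i) Finset.univ).card ≤ c + 1)
    (hhalf : volume (Set.Icc q.1 q.2) ≤
      2 * volume (Set.Icc q.1 q.2 ∩ ⋃ r ∈ G, Set.Icc r.1 r.2))
    {A : Set (Fin d → ℝ)} (hA : MeasurableSet A)
    (hGA : ∀ r ∈ G, Set.Icc (2 • r.1 - r.2) (2 • r.2 - r.1) ⊆ A) :
    (c = 0 → Set.Icc q.1 q.2 ⊆ A) ∧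
      (c ≠ 0 → Set.Icc q.1 q.2 ⊆ {x | 1 / 4 < strongMaximal d c (A.indicator 1) x}) := by
  by_cases hS : ∃ k, k ∉ S
  · obtain ⟨k, hk⟩ := hS
    have key := fun x hx => exists_shortened_rectangle hi₀ hq hqS hGS hGL hqc hhalf hGA hk (x := x) hx
    refine ⟨fun hc x hx => ?_, fun hc x hx => ?_⟩
    · obtain ⟨a, b, -, hcard, -⟩ := key x hx
      rw [hc, Nat.le_zero, Finset.card_eq_zero, Finset.image_eq_empty] at hcard
      exact absurd (Finset.mem_univ i₀) (hcard ▸ Finset.notMem_empty i₀)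
    · obtain ⟨a, b, hab, hcard, hxab, hab2⟩ := key x hx
      exact lt_strongMaximal_indicator hA hab hcard hxab hab2
  · push Not at hS
    have hlong : ∀ r : (Fin d → ℝ) × (Fin d → ℝ), longestCoords r = S → ∀ i j,
        r.2 j - r.1 j ≤ r.2 i - r.1 i := by
      intro r hr i
      have hi := hS i
      rw [← hr, longestCoords, Finset.mem_filter] at hi
      exact hi.2
    have hsub : Set.Icc q.1 q.2 ⊆ A := by
      have hne : (Set.Icc q.1 q.2 ∩ ⋃ r ∈ G, Set.Icc r.1 r.2).Nonempty := by
        by_contra hcon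
        rw [Set.not_nonempty_iff_eq_empty.1 hcon, measure_empty, mul_zero] at hhalf
        exact volume_Icc_ne_zero hq (le_antisymm hhalf zero_le)
      obtain ⟨y, hyq, hy⟩ := hne
      obtain ⟨r, hr, hyr⟩ := Set.mem_iUnion₂.1 hy
      refine fun x hx => hGA r hr ⟨fun i => ?_, fun i => ?_⟩
      all_goals
        have h1 := hyq.1 i
        have h2 := hyq.2 i
        have h3 := hyr.1 i
        have h4 := hyr.2 i
        have h5 := hx.1 i
        have h6 := hx.2 i
        have h7 := hlong q hqS i₀ i
        have h8 := hlong r (hGS r hr) i i₀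
        have h9 := hGL r hr
        simp
        linarith
    refine ⟨fun _ => hsub, fun hc x hx => ?_⟩
    refine lt_strongMaximal_indicator hA hq ?_ hx ?_
    · have : Finset.image (fun i => q.2 i - q.1 i) Finset.univ ⊆ {q.2 i₀ - q.1 i₀} := by
        intro z hz
        obtain ⟨i, -, rfl⟩ := Finset.mem_image.1 hz
        exact Finset.mem_singleton.2 (le_antisymm (hlong q hqS i₀ i) (hlong q hqS i i₀))
      have := Finset.card_le_card this
      rw [Finset.card_singleton] at this
      omega
    · rw [Set.inter_eq_left.2 hsub, two_mul]
      exact le_self_add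

lemma rpow_mul_sum_le_of_sparse {d c : ℕ} {p : ℝ} (hp : 1 < p) {K : ℝ≥0∞}
    (hK : ∀ g : (Fin d → ℝ) → ℝ≥0∞, Measurable g →
      ∃ T : (Fin d → ℝ) → ℝ≥0∞, Measurable T ∧ ∫⁻ x, T x ^ p ≤ K * ∫⁻ x, g x ^ p ∧
        ∀ a b : Fin d → ℝ, (∀ i, a i < b i) → ∀ x ∈ Set.Icc a b,
          (∫⁻ y in Set.Icc a b, g y) / volume (Set.Icc a b) ≤ T x)
    (V : (Fin d → ℝ) → ℝ≥0∞) {f : (Fin d → ℝ) → ℝ≥0∞} (hf : Measurable f) {t : ℝ≥0∞}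
    {G : Finset ((Fin d → ℝ) × (Fin d → ℝ))} (hG : ∀ q ∈ G, ∀ i, q.1 i < q.2 i)
    (hGc : ∀ q ∈ G, (Finset.image (fun i => q.2 i - q.1 i) Finset.univ).card ≤ c)
    (hGt : ∀ q ∈ G, t ≤ (∫⁻ y in Set.Icc q.1 q.2, f y) / volume (Set.Icc q.1 q.2))
    {E : (Fin d → ℝ) × (Fin d → ℝ) → Set (Fin d → ℝ)} (hE : ∀ q, MeasurableSet (E q))
    (hEG : ∀ q ∈ G, E q ⊆ Set.Icc q.1 q.2 ∧ volume (Set.Icc q.1 q.2) ≤ 2 * volume (E q))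
    (hdisj : (G : Set ((Fin d → ℝ) × (Fin d → ℝ))).PairwiseDisjoint E) :
    t ^ p * ∑ q ∈ G, ∫⁻ y in Set.Icc (2 • q.1 - q.2) (2 • q.2 - q.1), V y ≤
      3 ^ d * 2 * K * ∫⁻ x, f x ^ p * strongMaximal d c V x := by
  have hp0 : 0 < p := by linarith
  set v : (Fin d → ℝ) × (Fin d → ℝ) → ℝ≥0∞ := fun q =>
    (∫⁻ y in Set.Icc (2 • q.1 - q.2) (2 • q.2 - q.1), V y) /
      volume (Set.Icc (2 • q.1 - q.2) (2 • q.2 - q.1)) with hv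
  have hvV : ∀ q ∈ G, ∀ x ∈ Set.Icc q.1 q.2, v q ≤ strongMaximal d c V x := by
    intro q hq x hx
    refine average_le_strongMaximal V (dilate_lt (hG q hq)) ?_ (Icc_subset_dilate (hG q hq) hx)
    refine (card_image_mul_le q.1 q.2 _ _ 3 fun i => ?_).trans (hGc q hq)
    simp; ring
  set V₀ : (Fin d → ℝ) → ℝ≥0∞ := fun x =>
    ⨆ q : G, (Set.Icc q.1.1 q.1.2).indicator (fun _ => v q) x with hV₀
  have hV₀m : Measurable V₀ := Measurable.iSup fun _ => measurable_const.indicator measurableSet_Icc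
  have hV₀le : ∀ x, V₀ x ≤ strongMaximal d c V x := by
    refine fun x => iSup_le fun q => ?_
    by_cases hx : x ∈ Set.Icc q.1.1 q.1.2
    · rw [Set.indicator_of_mem hx]; exact hvV q q.2 x hx
    · rw [Set.indicator_of_notMem hx]; exact zero_le
  have hvV₀ : ∀ q ∈ G, ∀ x ∈ Set.Icc q.1 q.2, v q ≤ V₀ x := by
    intro q hq x hx
    refine le_iSup_of_le (⟨q, hq⟩ : G) ?_
    rw [Set.indicator_of_mem hx]
  obtain ⟨T, -, hTp, hT⟩ := hK (fun x => f x * V₀ x ^ (1 / p)) (hf.mul (hV₀m.pow_const _))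
  have hone : ∀ q ∈ G, t ^ p * ∫⁻ y in Set.Icc (2 • q.1 - q.2) (2 • q.2 - q.1), V y ≤
      3 ^ d * 2 * ∫⁻ x in E q, T x ^ p := by
    intro q hq
    have hTx : ∀ x ∈ E q, t ^ p * v q ≤ T x ^ p := by
      intro x hx
      have h1 : v q ^ (1 / p) * t ≤ T x := by
        refine le_trans ?_ (hT q.1 q.2 (hG q hq) x ((hEG q hq).1 hx))
        calc v q ^ (1 / p) * t
            ≤ v q ^ (1 / p) * ((∫⁻ y in Set.Icc q.1 q.2, f y) / volume (Set.Icc q.1 q.2)) := by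
              gcongr; exact hGt q hq
          _ = (∫⁻ y in Set.Icc q.1 q.2, v q ^ (1 / p) * f y) / volume (Set.Icc q.1 q.2) := by
              rw [lintegral_const_mul _ hf, mul_div_assoc]
          _ ≤ _ := by
              refine ENNReal.div_le_div_right (setLIntegral_mono' measurableSet_Icc fun y hy => ?_) _
              rw [mul_comm]
              gcongr
              exact hvV₀ q hq y hy
      calc t ^ p * v q = (v q ^ (1 / p) * t) ^ p := by
            rw [ENNReal.mul_rpow_of_nonneg _ _ hp0.le, ← ENNReal.rpow_mul,
              one_div_mul_cancel hp0.ne', ENNReal.rpow_one, mul_comm]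
        _ ≤ _ := by gcongr
    have h0 := volume_Icc_ne_zero (dilate_lt (hG q hq))
    have htop := volume_Icc_ne_top (2 • q.1 - q.2) (2 • q.2 - q.1)
    calc t ^ p * ∫⁻ y in Set.Icc (2 • q.1 - q.2) (2 • q.2 - q.1), V y
        = t ^ p * (v q * volume (Set.Icc (2 • q.1 - q.2) (2 • q.2 - q.1))) := by
          rw [hv, ENNReal.div_mul_cancel h0 htop]
      _ = 3 ^ d * (t ^ p * v q * volume (Set.Icc q.1 q.2)) := by rw [volume_dilate]; ring
      _ ≤ 3 ^ d * (t ^ p * v q * (2 * volume (E q))) := by gcongr; exact (hEG q hq).2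
      _ = 3 ^ d * 2 * ∫⁻ x in E q, t ^ p * v q := by rw [setLIntegral_const]; ring
      _ ≤ _ := by
          exact mul_le_mul' le_rfl (setLIntegral_mono' (hE q) hTx)
  calc t ^ p * ∑ q ∈ G, ∫⁻ y in Set.Icc (2 • q.1 - q.2) (2 • q.2 - q.1), V y
      ≤ ∑ q ∈ G, 3 ^ d * 2 * ∫⁻ x in E q, T x ^ p := by
        rw [Finset.mul_sum]
        exact Finset.sum_le_sum hone
    _ = 3 ^ d * 2 * ∫⁻ x in ⋃ q ∈ G, E q, T x ^ p := by
        rw [← Finset.mul_sum, lintegral_biUnion_finset hdisj fun q _ => hE q]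
    _ ≤ 3 ^ d * 2 * ∫⁻ x, T x ^ p := by gcongr; exact Measure.restrict_le_self
    _ ≤ 3 ^ d * 2 * (K * ∫⁻ x, (f x * V₀ x ^ (1 / p)) ^ p) := by gcongr
    _ ≤ 3 ^ d * 2 * (K * ∫⁻ x, f x ^ p * strongMaximal d c V x) := by
        gcongr with x
        rw [ENNReal.mul_rpow_of_nonneg _ _ hp0.le, ← ENNReal.rpow_mul,
              one_div_mul_cancel hp0.ne', ENNReal.rpow_one]
        gcongr
        exact hV₀le x
    _ = _ := by ring

/-- `w(B) ≤ K ∫_A 𝔐_c ⋯ 𝔐_1 w` whenever `B` is contained in `A` (for `c = 0`) or in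
`{𝔐_c 1_A > 1/4}` (for `c > 0`). -/
def HaloBound (d c : ℕ) (K : ℝ≥0∞) : Prop :=
  ∀ (w : (Fin d → ℝ) → ℝ≥0∞) (A B : Set (Fin d → ℝ)), MeasurableSet A →
    (c = 0 → B ⊆ A) → (c ≠ 0 → B ⊆ {x | 1 / 4 < strongMaximal d c (A.indicator 1) x}) →
    ∫⁻ x in B, w x ≤ K * ∫⁻ x in A, iterMaximal d c w x

lemma setLIntegral_biUnion_le_of_type {d c : ℕ} {p : ℝ} (hp : 1 < p) {K : ℝ≥0∞}
    (hK : ∀ g : (Fin d → ℝ) → ℝ≥0∞, Measurable g →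
      ∃ T : (Fin d → ℝ) → ℝ≥0∞, Measurable T ∧ ∫⁻ x, T x ^ p ≤ K * ∫⁻ x, g x ^ p ∧
        ∀ a b : Fin d → ℝ, (∀ i, a i < b i) → ∀ x ∈ Set.Icc a b,
          (∫⁻ y in Set.Icc a b, g y) / volume (Set.Icc a b) ≤ T x)
    {K₀ : ℝ≥0∞} (hK₀ : HaloBound d c K₀) (w : (Fin d → ℝ) → ℝ≥0∞)
    {f : (Fin d → ℝ) → ℝ≥0∞} (hf : Measurable f) {t : ℝ≥0∞}
    {S : Finset (Fin d)} {i₀ : Fin d} (hi₀ : i₀ ∈ S)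
    {F : Finset ((Fin d → ℝ) × (Fin d → ℝ))} (hF : ∀ q ∈ F, ∀ i, q.1 i < q.2 i)
    (hFc : ∀ q ∈ F, (Finset.image (fun i => q.2 i - q.1 i) Finset.univ).card ≤ c + 1)
    (hFt : ∀ q ∈ F, t ≤ (∫⁻ y in Set.Icc q.1 q.2, f y) / volume (Set.Icc q.1 q.2))
    (hFS : ∀ q ∈ F, longestCoords q = S) :
    t ^ p * ∫⁻ x in ⋃ q ∈ F, Set.Icc q.1 q.2, w x ≤
      K₀ * (3 ^ d * 2 * K) * ∫⁻ x, f x ^ p * iterMaximal d (c + 1) w x := by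
  obtain ⟨G, hGF, E, hE, hEG, hdisj, hcov⟩ := exists_sparse_subfamily volume
    (B := fun q : (Fin d → ℝ) × (Fin d → ℝ) => Set.Icc q.1 q.2) (fun _ => measurableSet_Icc)
    (fun q => q.2 i₀ - q.1 i₀) F (fun q _ => volume_Icc_ne_top q.1 q.2)
  set A : Set (Fin d → ℝ) := ⋃ q ∈ G, Set.Icc (2 • q.1 - q.2) (2 • q.2 - q.1) with hAdef
  have hA : MeasurableSet A := Finset.measurableSet_biUnion _ fun _ _ => measurableSet_Icc
  have hsub := fun q (hq : q ∈ F) => subset_dilates (G := {r ∈ G | q.2 i₀ - q.1 i₀ ≤ r.2 i₀ - r.1 i₀})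
    hi₀ (hF q hq) (hFS q hq)
    (fun r hr => hFS r (hGF (Finset.mem_filter.1 hr).1)) (fun r hr => (Finset.mem_filter.1 hr).2)
    (hFc q hq) (hcov q hq) hA
    (fun r hr => Set.subset_biUnion_of_mem (u := fun r : (Fin d → ℝ) × (Fin d → ℝ) =>
      Set.Icc (2 • r.1 - r.2) (2 • r.2 - r.1)) (Finset.mem_coe.2 (Finset.mem_filter.1 hr).1))
  have hB := hK₀ w A (⋃ q ∈ F, Set.Icc q.1 q.2) hA
    (fun hc => Set.iUnion₂_subset fun q hq => (hsub q hq).1 hc)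
    (fun hc => Set.iUnion₂_subset fun q hq => (hsub q hq).2 hc)
  have hAle : ∫⁻ x in A, iterMaximal d c w x ≤
      ∑ q ∈ G, ∫⁻ x in Set.Icc (2 • q.1 - q.2) (2 • q.2 - q.1), iterMaximal d c w x :=
    setLIntegral_biUnion_finset_le _ _ _
  calc _ ≤ t ^ p * (K₀ * ∑ q ∈ G, ∫⁻ x in Set.Icc (2 • q.1 - q.2) (2 • q.2 - q.1),
          iterMaximal d c w x) := by
        gcongr
        exact hB.trans (by gcongr)
    _ = K₀ * (t ^ p * ∑ q ∈ G, ∫⁻ x in Set.Icc (2 • q.1 - q.2) (2 • q.2 - q.1),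
          iterMaximal d c w x) := by ring
    _ ≤ K₀ * (3 ^ d * 2 * K * ∫⁻ x, f x ^ p * strongMaximal d (c + 1) (iterMaximal d c w) x) := by
        exact mul_le_mul' le_rfl (rpow_mul_sum_le_of_sparse hp hK (iterMaximal d c w) hf
          (fun q hq => hF q (hGF hq)) (fun q hq => hFc q (hGF hq)) (fun q hq => hFt q (hGF hq))
          hE hEG hdisj)
    _ = _ := by rw [mul_assoc K₀]; rfl

lemma longestCoords_nonempty {d : ℕ} (hd : 1 ≤ d) (q : (Fin d → ℝ) × (Fin d → ℝ)) :
    (longestCoords q).Nonempty := by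
  have : Nonempty (Fin d) := ⟨⟨0, hd⟩⟩
  obtain ⟨i, hi⟩ := Finite.exists_max fun i => q.2 i - q.1 i
  exact ⟨i, by rw [longestCoords, Finset.mem_filter]; exact ⟨Finset.mem_univ _, hi⟩⟩

lemma exists_finset_rectangles_bound {d c : ℕ} (hd : 1 ≤ d) {p : ℝ} (hp : 1 < p) {K₀ : ℝ≥0∞}
    (hK₀top : K₀ ≠ ∞) (hK₀ : HaloBound d c K₀) :
    ∃ K : ℝ≥0∞, K ≠ ∞ ∧ ∀ (w f : (Fin d → ℝ) → ℝ≥0∞), Measurable f → ∀ (t : ℝ≥0∞)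
      (F : Finset ((Fin d → ℝ) × (Fin d → ℝ))), (∀ q ∈ F, ∀ i, q.1 i < q.2 i) →
      (∀ q ∈ F, (Finset.image (fun i => q.2 i - q.1 i) Finset.univ).card ≤ c + 1) →
      (∀ q ∈ F, t ≤ (∫⁻ y in Set.Icc q.1 q.2, f y) / volume (Set.Icc q.1 q.2)) →
      t ^ p * ∫⁻ x in ⋃ q ∈ F, Set.Icc q.1 q.2, w x ≤
        K * ∫⁻ x, f x ^ p * iterMaximal d (c + 1) w x := by
  obtain ⟨K, hKtop, hK⟩ := exists_average_majorant d hp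
  refine ⟨Fintype.card (Finset (Fin d)) * (K₀ * (3 ^ d * 2 * K)), ?_, ?_⟩
  · refine ENNReal.mul_ne_top (ENNReal.natCast_ne_top _) (ENNReal.mul_ne_top hK₀top ?_)
    exact ENNReal.mul_ne_top (ENNReal.mul_ne_top (by simp) (by simp)) hKtop
  intro w f hf t F hF hFc hFt
  have hsub : (⋃ q ∈ F, Set.Icc q.1 q.2) ⊆ ⋃ S ∈ (Finset.univ : Finset (Finset (Fin d))),
      ⋃ q ∈ {q ∈ F | longestCoords q = S}, Set.Icc q.1 q.2 := by
    intro x hx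
    obtain ⟨q, hq, hxq⟩ := Set.mem_iUnion₂.1 hx
    exact Set.mem_biUnion (Finset.mem_coe.2 (Finset.mem_univ (longestCoords q)))
      (Set.mem_biUnion (Finset.mem_coe.2 (Finset.mem_filter.2 ⟨hq, rfl⟩)) hxq)
  calc t ^ p * ∫⁻ x in ⋃ q ∈ F, Set.Icc q.1 q.2, w x
      ≤ t ^ p * ∑ S : Finset (Fin d),
          ∫⁻ x in ⋃ q ∈ {q ∈ F | longestCoords q = S}, Set.Icc q.1 q.2, w x := by
        refine mul_le_mul' le_rfl ?_
        exact (lintegral_mono_set hsub).trans (setLIntegral_biUnion_finset_le _ _ _)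
    _ ≤ ∑ S : Finset (Fin d),
          K₀ * (3 ^ d * 2 * K) * ∫⁻ x, f x ^ p * iterMaximal d (c + 1) w x := by
        rw [Finset.mul_sum]
        refine Finset.sum_le_sum fun S _ => ?_
        rcases S.eq_empty_or_nonempty with hS | ⟨i₀, hi₀⟩
        · have : ({q ∈ F | longestCoords q = S} : Finset _) = ∅ := by
            refine Finset.filter_eq_empty_iff.2 fun q _ hq => ?_
            exact (longestCoords_nonempty hd q).ne_empty (hq.trans hS)
          simp [this]
        · exact setLIntegral_biUnion_le_of_type hp hK hK₀ w hf hi₀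
            (fun q hq => hF q (Finset.mem_filter.1 hq).1)
            (fun q hq => hFc q (Finset.mem_filter.1 hq).1)
            (fun q hq => hFt q (Finset.mem_filter.1 hq).1)
            (fun q hq => (Finset.mem_filter.1 hq).2)
    _ = _ := by
        rw [Finset.sum_const, nsmul_eq_mul, Finset.card_univ]
        ring

lemma exists_weak_type_of_haloBound {d c : ℕ} (hd : 1 ≤ d) {p : ℝ} (hp : 1 < p) {K₀ : ℝ≥0∞}
    (hK₀top : K₀ ≠ ∞) (hK₀ : HaloBound d c K₀) :
    ∃ K : ℝ≥0∞, K ≠ ∞ ∧ ∀ (w f : (Fin d → ℝ) → ℝ≥0∞), Measurable f → ∀ t : ℝ≥0∞,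
      t ^ p * ∫⁻ x in {x | t < strongMaximal d (c + 1) f x}, w x ≤
        K * ∫⁻ x, f x ^ p * iterMaximal d (c + 1) w x := by
  obtain ⟨K, hKtop, hK⟩ := exists_finset_rectangles_bound hd hp hK₀top hK₀
  have h3top : ((3 : ℝ≥0∞) ^ d) ^ p ≠ ∞ := ENNReal.rpow_ne_top_of_nonneg (by linarith) (by simp)
  refine ⟨(3 ^ d) ^ p * K, ENNReal.mul_ne_top h3top hKtop, fun w f hf t => ?_⟩
  set Q : Set ((Fin d → ℝ) × (Fin d → ℝ)) := {q | (∀ i, q.1 i < q.2 i) ∧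
    (Finset.image (fun i => q.2 i - q.1 i) Finset.univ).card ≤ c + 1 ∧
    t / 3 ^ d ≤ (∫⁻ y in Set.Icc q.1 q.2, f y) / volume (Set.Icc q.1 q.2)} with hQ
  have hcover : {x | t < strongMaximal d (c + 1) f x} ⊆
      ⋃ q ∈ Q, Set.pi Set.univ fun i => Set.Ioo (q.1 i) (q.2 i) := by
    intro x hx
    simp only [strongMaximal, Set.mem_ofPred_eq, lt_iSup_iff] at hx
    obtain ⟨a, b, hab, hcard, hxab, hlt⟩ := hx
    refine Set.mem_biUnion (x := (2 • a - b, 2 • b - a)) ⟨dilate_lt hab, ?_, ?_⟩ fun i _ => ?_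
    · exact (card_image_mul_le a b _ _ 3 fun i => by simp; ring).trans hcard
    · refine (ENNReal.div_le_div_right hlt.le _).trans ?_
      rw [volume_dilate, div_eq_mul_inv, div_eq_mul_inv, div_eq_mul_inv, mul_assoc,
        ENNReal.mul_inv (Or.inl (by simp)) (Or.inl (by simp)), mul_comm (volume _)⁻¹]
      exact mul_le_mul' (lintegral_mono_set (Icc_subset_dilate hab)) le_rfl
    · have h1 := hab i
      have h2 := hxab.1 i
      have h3 := hxab.2 i
      constructor <;> simp <;> linarith
  obtain ⟨U, hUQ, hUc, hU⟩ := TopologicalSpace.isOpen_biUnion_countable Q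
    (fun q => Set.pi Set.univ fun i => Set.Ioo (q.1 i) (q.2 i))
    (fun q _ => isOpen_set_pi Set.finite_univ fun i _ => isOpen_Ioo)
  have : Countable U := hUc.to_subtype
  have hsub : {x | t < strongMaximal d (c + 1) f x} ⊆
      ⋃ F : Finset U, ⋃ q ∈ F, Set.Icc q.1.1 q.1.2 := by
    refine hcover.trans (hU.symm.subset.trans (Set.iUnion₂_subset fun q hq x hx => ?_))
    refine Set.mem_iUnion.2 ⟨{⟨q, hq⟩}, ?_⟩
    simp only [Finset.mem_singleton, Set.iUnion_iUnion_eq_left]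
    exact ⟨fun i => (hx i trivial).1.le, fun i => (hx i trivial).2.le⟩
  have hmeas : ∀ F : Finset U, MeasurableSet (⋃ q ∈ F, Set.Icc q.1.1 q.1.2) := fun F =>
    Finset.measurableSet_biUnion _ fun _ _ => measurableSet_Icc
  have hdir : Directed (· ⊆ ·) fun F : Finset U => ⋃ q ∈ F, Set.Icc q.1.1 q.1.2 :=
    Monotone.directed_le fun F F' h => Set.biUnion_subset_biUnion_left h
  have hle : ∫⁻ x in {x | t < strongMaximal d (c + 1) f x}, w x ≤
      ⨆ F : Finset U, ∫⁻ x in ⋃ q ∈ F, Set.Icc q.1.1 q.1.2, w x := by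
    refine (lintegral_mono_set hsub).trans_eq ?_
    rw [← withDensity_apply _ (MeasurableSet.iUnion hmeas), hdir.measure_iUnion]
    simp_rw [withDensity_apply _ (hmeas _)]
  have h3 : t ^ p = (3 ^ d) ^ p * (t / 3 ^ d) ^ p := by
    rw [← ENNReal.mul_rpow_of_nonneg _ _ (by linarith), ENNReal.mul_div_cancel (by simp) (by simp)]
  calc _ ≤ t ^ p * ⨆ F : Finset U, ∫⁻ x in ⋃ q ∈ F, Set.Icc q.1.1 q.1.2, w x :=
        mul_le_mul' le_rfl hle
    _ = ⨆ F : Finset U, t ^ p * ∫⁻ x in ⋃ q ∈ F, Set.Icc q.1.1 q.1.2, w x := ENNReal.mul_iSup _ _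
    _ ≤ _ := by
        refine iSup_le fun F => ?_
        rw [h3, mul_assoc, mul_assoc]
        refine mul_le_mul' le_rfl ?_
        have hmem : ∀ q ∈ F.map (Function.Embedding.subtype _), q ∈ Q := by
          intro q hq
          obtain ⟨q', -, rfl⟩ := Finset.mem_map.1 hq
          exact hUQ q'.2
        have := hK w f hf (t / 3 ^ d) (F.map (Function.Embedding.subtype _))
          (fun q hq => (hmem q hq).1) (fun q hq => (hmem q hq).2.1) (fun q hq => (hmem q hq).2.2)
        refine (mul_le_mul' le_rfl (lintegral_mono_set ?_)).trans this
        exact Set.iUnion₂_subset fun q hq => Set.subset_biUnion_of_mem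
          (u := fun q : (Fin d → ℝ) × (Fin d → ℝ) => Set.Icc q.1 q.2)
          (Finset.mem_coe.2 (Finset.mem_map_of_mem (Function.Embedding.subtype _) hq))

lemma exists_haloBound {d : ℕ} (hd : 1 ≤ d) (c : ℕ) : ∃ K : ℝ≥0∞, K ≠ ∞ ∧ HaloBound d c K := by
  induction c with
  | zero =>
    refine ⟨1, one_ne_top, fun w A B _ hB _ => ?_⟩
    rw [one_mul]
    exact lintegral_mono_set (hB rfl)
  | succ c ih =>
    obtain ⟨K₀, hK₀top, hK₀⟩ := ih
    obtain ⟨K, hKtop, hK⟩ := exists_weak_type_of_haloBound hd one_lt_two hK₀top hK₀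
    have h4 : ((1 : ℝ≥0∞) / 4) ^ (2 : ℝ) ≠ 0 := by simp
    have h4' : ((1 : ℝ≥0∞) / 4) ^ (2 : ℝ) ≠ ∞ :=
      ENNReal.rpow_ne_top_of_nonneg (by norm_num) (by simp)
    refine ⟨(((1 : ℝ≥0∞) / 4) ^ (2 : ℝ))⁻¹ * K,
      ENNReal.mul_ne_top (ENNReal.inv_ne_top.2 h4) hKtop, fun w A B hA _ hB => ?_⟩
    have h1 := hK w (A.indicator 1) (measurable_one.indicator hA) (1 / 4)
    have h2 : ∫⁻ x, A.indicator (1 : (Fin d → ℝ) → ℝ≥0∞) x ^ (2 : ℝ) * iterMaximal d (c + 1) w x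
        = ∫⁻ x in A, iterMaximal d (c + 1) w x := by
      rw [← lintegral_indicator hA]
      refine lintegral_congr fun x => ?_
      by_cases hx : x ∈ A <;> simp [hx]
    rw [h2] at h1
    calc ∫⁻ x in B, w x ≤ ∫⁻ x in {x | 1 / 4 < strongMaximal d (c + 1) (A.indicator 1) x}, w x :=
          lintegral_mono_set (hB (Nat.succ_ne_zero c))
      _ = (((1 : ℝ≥0∞) / 4) ^ (2 : ℝ))⁻¹ * (((1 : ℝ≥0∞) / 4) ^ (2 : ℝ) *
            ∫⁻ x in {x | 1 / 4 < strongMaximal d (c + 1) (A.indicator 1) x}, w x) := by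
          rw [← mul_assoc, ENNReal.inv_mul_cancel h4 h4', one_mul]
      _ ≤ _ := by
          rw [mul_assoc]
          exact mul_le_mul' le_rfl h1

lemma strongMaximal_congr_ae {d c : ℕ} {f g : (Fin d → ℝ) → ℝ≥0∞} (h : f =ᵐ[volume] g) :
    strongMaximal d c f = strongMaximal d c g := by
  ext x
  unfold strongMaximal
  have : ∀ a b : Fin d → ℝ, ∫⁻ y in Set.Icc a b, f y = ∫⁻ y in Set.Icc a b, g y := fun a b =>
    lintegral_congr_ae (ae_restrict_of_ae h)
  simp_rw [this]

/-- The Fefferman–Stein type weak inequality for the strong maximal operator of complexity `c`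
with the composed weight `W = 𝔐_c 𝔐_{c-1} ⋯ 𝔐_1 w`. -/
theorem fefferman_stein_weak_type_composition
    (d c : ℕ) (hd : 1 ≤ d) (hc : 1 ≤ c) (hcd : c ≤ d) (p : ℝ) (hp : 1 < p) :
    ∃ C : ℝ, 0 < C ∧
      ∀ w : (Fin d → ℝ) → ℝ, (∀ x, 0 ≤ w x) → LocallyIntegrable w →
      ∀ f : (Fin d → ℝ) → ℝ, LocallyIntegrable f →
      ∀ t : ℝ, 0 < t →
        (∫⁻ x in {x | ENNReal.ofReal t <
              strongMaximal d c (fun y => ENNReal.ofReal |f y|) x},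
            ENNReal.ofReal (w x)) ^ (1 / p)
          ≤ ENNReal.ofReal (C / t) *
            (∫⁻ x, ENNReal.ofReal |f x| ^ p *
              iterMaximal d c (fun y => ENNReal.ofReal (w y)) x) ^ (1 / p) := by
  have hp0 : 0 < p := by linarith
  obtain ⟨c, rfl⟩ : ∃ n, c = n + 1 := ⟨c - 1, by omega⟩
  obtain ⟨K₀, hK₀top, hK₀⟩ := exists_haloBound hd c
  obtain ⟨K, hKtop, hK⟩ := exists_weak_type_of_haloBound hd hp hK₀top hK₀
  have hKp : K ^ (1 / p) ≠ ∞ := ENNReal.rpow_ne_top_of_nonneg (by positivity) hKtop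
  refine ⟨(K ^ (1 / p)).toReal + 1, by positivity, fun w _ _ f hf t ht => ?_⟩
  have hfm : AEMeasurable (fun y => ENNReal.ofReal |f y|) volume :=
    (measurable_norm.comp_aemeasurable hf.aestronglyMeasurable.aemeasurable).ennreal_ofReal
  have hae := hfm.ae_eq_mk
  have h1 := hK (fun y => ENNReal.ofReal (w y)) _ hfm.measurable_mk (ENNReal.ofReal t)
  have hint : ∫⁻ x, hfm.mk _ x ^ p * iterMaximal d (c + 1) (fun y => ENNReal.ofReal (w y)) x =
      ∫⁻ x, ENNReal.ofReal |f x| ^ p * iterMaximal d (c + 1) (fun y => ENNReal.ofReal (w y)) x :=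
    lintegral_congr_ae (by filter_upwards [hae] with x hx; rw [hx])
  rw [← strongMaximal_congr_ae hae, hint] at h1
  have h2 := ENNReal.rpow_le_rpow h1 (show 0 ≤ 1 / p by positivity)
  rw [ENNReal.mul_rpow_of_nonneg _ _ (by positivity), ENNReal.mul_rpow_of_nonneg _ _ (by positivity),
    ← ENNReal.rpow_mul, mul_one_div_cancel hp0.ne', ENNReal.rpow_one, mul_comm,
    ← ENNReal.le_div_iff_mul_le (Or.inl (by simpa using ht)) (Or.inl ENNReal.ofReal_ne_top)] at h2
  refine h2.trans ?_
  rw [ENNReal.ofReal_div_of_pos ht, ENNReal.mul_div_right_comm]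
  gcongr
  rw [ENNReal.le_ofReal_iff_toReal_le hKp (by positivity)]
  linarith
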